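/- Let R be a noetherian local domain with maximal ideal m_R, let A and B be subgroups of (ℝ,+), and let ν be a valuation of the fraction field of R with values in Γ = A × B ordered lexicographically, dominating R. Let π : Γ → A be the first projection, ν₂ = π∘ν, and let p₂ = {x ∈ R : ν₂(x) > 0}; assume (0) ≠ p₂ ≠ m_R and that ν(R∖{0}) is well ordered. Let t₁ = min{ν(f) : f ∈ m_R∖{0}}. Then for each φ₂ ∈ ν₂(R∖{0}), setting φ̃₂ = min{ν(f) : f ∈ R∖{0}, ν₂(f) = φ₂}, there exist d, s ∈ ℕ such that for every integer n > s the set {φ ∈ ν(m_R∖{0}) : φ̃₂ ≤ φ < φ̃₂ + n·t₁} is finite with cardinality strictly less than d·n^e, where e is the Krull dimension of R/p₂. -/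

import Mathlib

/-- The elements of `R` that vanish or have `v`-value at least `γ`. -/
def valueIdeal {R Γ : Type*} [CommRing R] [IsDomain R] [AddCommGroup Γ] [LinearOrder Γ]
    [IsOrderedAddMonoid Γ] (v : R → Γ)
    (hmul : ∀ x y : R, x ≠ 0 → y ≠ 0 → v (x * y) = v x + v y)
    (hadd : ∀ x y : R, x ≠ 0 → y ≠ 0 → x + y ≠ 0 → min (v x) (v y) ≤ v (x + y))
    (hnonneg : ∀ x : R, x ≠ 0 → 0 ≤ v x) (γ : Γ) : Ideal R where
  carrier := {x | x ≠ 0 → γ ≤ v x}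
  zero_mem' h := absurd rfl h
  add_mem' {x y} hx hy hxy := by
    by_cases hx0 : x = 0
    · subst hx0
      simpa using hy (by simpa using hxy)
    by_cases hy0 : y = 0
    · subst hy0
      simpa using hx hx0
    exact (le_min (hx hx0) (hy hy0)).trans (hadd x y hx0 hy0 hxy)
  smul_mem' c x hx hcx := by
    have hc : c ≠ 0 := left_ne_zero_of_mul hcx
    have hx0 : x ≠ 0 := right_ne_zero_of_mul hcx
    rw [smul_eq_mul, hmul c x hc hx0]
    exact (hx hx0).trans (le_add_of_nonneg_left (hnonneg c hc))

/-- Values attained in `[φ, θ)` are bounded in number by the length of the quotient of the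
corresponding value ideals. -/
theorem card_le_length_valueIdeal {R Γ : Type*} [CommRing R] [IsDomain R] [AddCommGroup Γ]
    [LinearOrder Γ] [IsOrderedAddMonoid Γ] (v : R → Γ)
    (hmul : ∀ x y : R, x ≠ 0 → y ≠ 0 → v (x * y) = v x + v y)
    (hadd : ∀ x y : R, x ≠ 0 → y ≠ 0 → x + y ≠ 0 → min (v x) (v y) ≤ v (x + y))
    (hnonneg : ∀ x : R, x ≠ 0 → 0 ≤ v x) (φ θ : Γ) (T : Finset Γ)
    (hT : ∀ γ ∈ T, φ ≤ γ ∧ γ < θ ∧ ∃ x : R, x ≠ 0 ∧ v x = γ) :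
    (T.card : ℕ∞) ≤ Module.length R
      (valueIdeal v hmul hadd hnonneg φ ⧸ Submodule.comap
        (valueIdeal v hmul hadd hnonneg φ).subtype (valueIdeal v hmul hadd hnonneg θ)) := by
  classical
  set F := valueIdeal v hmul hadd hnonneg
  set N : Submodule R (F φ) := Submodule.comap (F φ).subtype (F θ)
  have hθ : θ ∉ T := fun h => (hT θ h).2.1.false
  have hcard : (insert θ T).card = T.card + 1 := Finset.card_insert_of_notMem hθ
  have hle : ∀ γ ∈ insert θ T, γ ≤ θ := by
    intro γ hγ
    rcases Finset.mem_insert.1 hγ with rfl | h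
    · exact le_rfl
    · exact (hT γ h).2.1.le
  have hanti : ∀ {γ γ' : Γ}, γ ≤ γ' → F γ' ≤ F γ := fun h x hx h0 => h.trans (hx h0)
  let G : Γ → Submodule R (F φ ⧸ N) := fun γ => (Submodule.comap (F φ).subtype (F γ)).map N.mkQ
  have hG : ∀ γ ∈ insert θ T, ∀ γ' ∈ insert θ T, γ < γ' → G γ' < G γ := by
    intro γ hγ γ' hγ' hlt
    refine lt_of_le_not_ge (Submodule.map_mono (Submodule.comap_mono (hanti hlt.le))) ?_
    intro hge
    have hγT : γ ∈ T := by
      rcases Finset.mem_insert.1 hγ with rfl | h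
      · exact absurd (hle γ' hγ') (not_le.2 hlt)
      · exact h
    obtain ⟨h1, -, x, hx0, rfl⟩ := hT γ hγT
    have hxφ : x ∈ F φ := fun _ => h1
    have hx : N.mkQ ⟨x, hxφ⟩ ∈ G (v x) := ⟨⟨x, hxφ⟩, fun _ => le_rfl, rfl⟩
    obtain ⟨y, hy, hyx⟩ := hge hx
    have hsub : y - ⟨x, hxφ⟩ ∈ N := (Submodule.Quotient.eq N).1 hyx
    have hsub' : (y : R) - x ∈ F γ' := hanti (hle γ' hγ') hsub
    have hxγ : x ∈ F γ' := by
      have := (F γ').sub_mem hy hsub'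
      simpa using this
    exact absurd (hxγ hx0) (not_le.2 hlt)
  let o := (insert θ T).orderEmbOfFin hcard
  have ho : ∀ i, o i ∈ insert θ T := fun i => Finset.orderEmbOfFin_mem _ hcard i
  let L : LTSeries (Submodule R (F φ ⧸ N)) := LTSeries.mk T.card (fun i => G (o i.rev)) (by
    intro i j hij
    exact hG _ (ho _) _ (ho _) (o.lt_iff_lt.2 (Fin.rev_lt_rev.2 hij)))
  have := Order.LTSeries.length_le_krullDim L
  rw [← Module.coe_length] at this
  exact_mod_cast this

theorem length_quotient_sup_pow_smul_top_le {R M : Type*} [CommRing R] [AddCommGroup M]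
    [Module R M] (N : Submodule R M) (a : R) (n : ℕ) :
    Module.length R (M ⧸ (N ⊔ Ideal.span {a ^ n} • (⊤ : Submodule R M))) ≤
      n * Module.length R (M ⧸ (N ⊔ Ideal.span {a} • (⊤ : Submodule R M))) := by
  induction n with
  | zero =>
    have : Subsingleton (M ⧸ (N ⊔ Ideal.span {a ^ 0} • (⊤ : Submodule R M))) := by
      rw [Submodule.Quotient.subsingleton_iff]
      simp
    simp [Module.length_eq_zero]
  | succ n ih =>
    set U := N ⊔ Ideal.span {a ^ (n + 1)} • (⊤ : Submodule R M)
    set V := N ⊔ Ideal.span {a ^ n} • (⊤ : Submodule R M)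
    set W := N ⊔ Ideal.span {a} • (⊤ : Submodule R M)
    have hWU : W ≤ U.comap (LinearMap.lsmul R M (a ^ n)) := by
      refine sup_le (fun x hx => ?_) (Submodule.smul_le.2 fun r hr x _ => ?_)
      · exact Submodule.mem_sup_left (N.smul_mem _ hx)
      · refine Submodule.mem_sup_right ?_
        change a ^ n • r • x ∈ _
        rw [smul_smul]
        refine Submodule.smul_mem_smul ?_ trivial
        rw [Ideal.mem_span_singleton] at hr ⊢
        rw [pow_succ]
        exact mul_dvd_mul_left _ hr
    let f : (M ⧸ W) →ₗ[R] (M ⧸ U) := W.mapQ U (LinearMap.lsmul R M (a ^ n)) hWU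
    let g : M →ₗ[R] ((M ⧸ U) ⧸ LinearMap.range f) := (LinearMap.range f).mkQ ∘ₗ U.mkQ
    have hg : V ≤ LinearMap.ker g := by
      refine sup_le (fun x hx => ?_) (Submodule.smul_le.2 fun r hr x _ => ?_)
      · have : U.mkQ x = 0 := by
          simpa using (Submodule.mem_sup_left hx : x ∈ U)
        simp only [g, LinearMap.mem_ker, LinearMap.comp_apply, this, map_zero]
      · obtain ⟨c, rfl⟩ := Ideal.mem_span_singleton.1 hr
        simp only [g, LinearMap.mem_ker, LinearMap.comp_apply]
        refine (Submodule.Quotient.mk_eq_zero _).2 ⟨W.mkQ (c • x), ?_⟩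
        simp [f, mul_smul, smul_comm c (a ^ n)]
    have hgs : Function.Surjective (V.liftQ g hg) := by
      rw [← LinearMap.range_eq_top, Submodule.range_liftQ, LinearMap.range_eq_top]
      exact (Submodule.mkQ_surjective _).comp (Submodule.mkQ_surjective _)
    have h1 := Module.length_eq_add_of_exact (LinearMap.range f).subtype (LinearMap.range f).mkQ
      (Submodule.subtype_injective _) (Submodule.mkQ_surjective _)
      (LinearMap.exact_subtype_mkQ _)
    have h2 := Module.length_le_of_surjective _ f.surjective_rangeRestrict
    have h3 := Module.length_le_of_surjective _ hgs
    rw [h1]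
    push_cast
    rw [add_mul, one_mul, add_comm]
    exact add_le_add (h3.trans ih) h2

theorem length_quotient_sup_span_pow_smul_top_le {R M ι : Type*} [CommRing R] [AddCommGroup M]
    [Module R M] (g : ι → R) (n : ℕ) (s : Finset ι) (N : Submodule R M) :
    Module.length R (M ⧸ (N ⊔ Ideal.span ((fun i => g i ^ n) '' s) • (⊤ : Submodule R M))) ≤
      (n : ℕ∞) ^ s.card *
        Module.length R (M ⧸ (N ⊔ Ideal.span (g '' s) • (⊤ : Submodule R M))) := by
  classical
  induction s using Finset.induction_on generalizing N with
  | empty =>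
    rw [Finset.coe_empty, Set.image_empty, Set.image_empty]
    simp
  | insert a s ha ih =>
    have key : ∀ (h : ι → R), N ⊔ Ideal.span (h '' ↑(insert a s)) • (⊤ : Submodule R M) =
        (N ⊔ Ideal.span {h a} • (⊤ : Submodule R M)) ⊔ Ideal.span (h '' s) • ⊤ := by
      intro h
      rw [Finset.coe_insert, Set.image_insert_eq, Ideal.span_insert, Submodule.sup_smul, sup_assoc]
    rw [key, key, Finset.card_insert_of_notMem ha]
    refine (ih _).trans ?_
    rw [pow_succ, mul_assoc, sup_right_comm, sup_right_comm _ (Ideal.span {g a} • ⊤)]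
    gcongr
    exact length_quotient_sup_pow_smul_top_le _ _ _

theorem length_quotient_smul_top_ne_top {R M : Type*} [CommRing R] [AddCommGroup M] [Module R M]
    [Module.Finite R M] (q : Ideal R) [IsArtinianRing (R ⧸ q)] :
    Module.length R (M ⧸ (q • (⊤ : Submodule R M))) ≠ ⊤ := by
  have : Module.Finite (R ⧸ q) (M ⧸ (q • (⊤ : Submodule R M))) :=
    Module.Finite.of_restrictScalars_finite R _ _
  rw [Module.length_eq_of_surjective (S := R) (R := R ⧸ q) Ideal.Quotient.mk_surjective]
  exact Module.length_ne_top

/-- Lifting a system of parameters of `R ⧸ p` gives, together with `p`, an ideal of finite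
colength. -/
theorem exists_finset_isArtinianRing_quotient {R : Type*} [CommRing R] [IsNoetherianRing R]
    [IsLocalRing R] (p : Ideal R) [p.IsPrime] (e : ℕ) (he : ringKrullDim (R ⧸ p) = e) :
    ∃ (s : Finset (R ⧸ p)) (g : R ⧸ p → R), s.card = e ∧
      (∀ a ∈ s, g a ∈ IsLocalRing.maximalIdeal R) ∧
      IsArtinianRing (R ⧸ (p ⊔ Ideal.span (g '' s))) := by
  have : IsLocalRing (R ⧸ p) := .of_surjective' (Ideal.Quotient.mk p) Ideal.Quotient.mk_surjective
  obtain ⟨s, hs, hcard⟩ :=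
    (IsLocalRing.maximalIdeal (R ⧸ p)).exists_finset_card_eq_height_of_isNoetherianRing
  have hcomap : (IsLocalRing.maximalIdeal (R ⧸ p)).comap (Ideal.Quotient.mk p) =
      IsLocalRing.maximalIdeal R := by
    have := Ideal.comap_isMaximal_of_surjective (Ideal.Quotient.mk p)
      Ideal.Quotient.mk_surjective (K := IsLocalRing.maximalIdeal (R ⧸ p))
    exact IsLocalRing.eq_maximalIdeal this
  refine ⟨s, Quotient.out, ?_, ?_, ?_⟩
  · have h := IsLocalRing.maximalIdeal_height_eq_ringKrullDim (R := R ⧸ p)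
    rw [he, ← hcard] at h
    exact_mod_cast h
  · intro a ha
    rw [← hcomap, Ideal.mem_comap]
    have : Ideal.Quotient.mk p (Quotient.out a) = a := Quotient.out_eq a
    rw [this]
    exact hs.1.2 (Ideal.subset_span ha)
  · have hq : p ⊔ Ideal.span (Quotient.out '' (s : Set (R ⧸ p))) =
        (Ideal.span (s : Set (R ⧸ p))).comap (Ideal.Quotient.mk p) := by
      have hspan : Ideal.span (s : Set (R ⧸ p)) =
          (Ideal.span (Quotient.out '' (s : Set (R ⧸ p)))).map (Ideal.Quotient.mk p) := by
        rw [Ideal.map_span, Set.image_image]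
        congr 1
        have : ∀ a : R ⧸ p, Ideal.Quotient.mk p (Quotient.out a) = a := Quotient.out_eq
        simp [this]
      rw [hspan, Ideal.comap_map_of_surjective' _ Ideal.Quotient.mk_surjective, Ideal.mk_ker,
        sup_comm]
    refine IsLocalRing.quotient_artinian_of_mem_minimalPrimes_of_isLocalRing _ ?_
    rw [hq, ← hcomap, Ideal.comap_minimalPrimes_eq_of_surjective Ideal.Quotient.mk_surjective]
    exact ⟨_, hs, rfl⟩


/-- `R` a noetherian local domain, `ν` a valuation of its fraction field with
values in `Γ = A × B ⊆ ℝ ×ₗ ℝ` (lex order) dominating `R`, `ν₂ = π ∘ ν`, `p₂` the center of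
`ν₂` with `(0) ≠ p₂ ≠ m_R`, `ν(R∖{0})` well ordered and `t₁ = ν(m_R)`.  Then for each
`φ₂ ∈ ν₂(R∖{0})`, with `φ̃₂` the least value of `ν` on elements of `ν₂`-value `φ₂`, there are
`d, s ∈ ℕ` such that for `n > s` the set `{φ ∈ ν(m_R∖{0}) : φ̃₂ ≤ φ < φ̃₂ + n·t₁}` is finite
of cardinality `< d·n^e` where `e = dim R/p₂`. -/
theorem stmt5 (R : Type*) [CommRing R] [IsDomain R] [IsNoetherianRing R] [IsLocalRing R]
    (K : Type*) [Field K] [Algebra R K] [IsFractionRing R K]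
    (A B : AddSubgroup ℝ)
    (ν : K → ℝ ×ₗ ℝ)
    (hval : ∀ x : K, x ≠ 0 → (ofLex (ν x)).1 ∈ A ∧ (ofLex (ν x)).2 ∈ B)
    (hmul : ∀ x y : K, x ≠ 0 → y ≠ 0 → ν (x * y) = ν x + ν y)
    (hadd : ∀ x y : K, x ≠ 0 → y ≠ 0 → x + y ≠ 0 → min (ν x) (ν y) ≤ ν (x + y))
    (hnonneg : ∀ x : R, x ≠ 0 → 0 ≤ ν (algebraMap R K x))
    (hdom : ∀ x : R, x ∈ IsLocalRing.maximalIdeal R → x ≠ 0 → 0 < ν (algebraMap R K x))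
    (p₂ : Ideal R) [p₂.IsPrime]
    (hp₂ : ∀ x : R, x ∈ p₂ ↔ (x = 0 ∨ 0 < (ofLex (ν (algebraMap R K x))).1))
    (hp₂ne : p₂ ≠ ⊥) (hp₂nem : p₂ ≠ IsLocalRing.maximalIdeal R)
    (hWF : Set.IsWF {γ : ℝ ×ₗ ℝ | ∃ x : R, x ≠ 0 ∧ ν (algebraMap R K x) = γ})
    (t₁ : ℝ ×ₗ ℝ)
    (ht₁ : IsLeast {γ : ℝ ×ₗ ℝ | ∃ x : R, x ∈ IsLocalRing.maximalIdeal R ∧ x ≠ 0 ∧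
      ν (algebraMap R K x) = γ} t₁)
    (φ₂ : ℝ)
    (hφ₂ : ∃ x : R, x ≠ 0 ∧ (ofLex (ν (algebraMap R K x))).1 = φ₂)
    (φt : ℝ ×ₗ ℝ)
    (hφt : IsLeast {γ : ℝ ×ₗ ℝ | ∃ x : R, x ≠ 0 ∧ (ofLex (ν (algebraMap R K x))).1 = φ₂ ∧
      ν (algebraMap R K x) = γ} φt)
    (e : ℕ) (he : ringKrullDim (R ⧸ p₂) = e) :
    ∃ d s : ℕ, ∀ n : ℕ, s < n →
      {γ : ℝ ×ₗ ℝ | (∃ x : R, x ∈ IsLocalRing.maximalIdeal R ∧ x ≠ 0 ∧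
          ν (algebraMap R K x) = γ) ∧ φt ≤ γ ∧ γ < φt + n • t₁}.Finite ∧
      {γ : ℝ ×ₗ ℝ | (∃ x : R, x ∈ IsLocalRing.maximalIdeal R ∧ x ≠ 0 ∧
          ν (algebraMap R K x) = γ) ∧ φt ≤ γ ∧ γ < φt + n • t₁}.ncard < d * n ^ e := by
  have hinj : Function.Injective (algebraMap R K) := IsFractionRing.injective R K
  have h0 : ∀ {x : R}, x ≠ 0 → algebraMap R K x ≠ 0 := fun hx => by
    simpa using hinj.ne hx
  let v : R → ℝ ×ₗ ℝ := fun x => ν (algebraMap R K x)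
  have vmul : ∀ x y : R, x ≠ 0 → y ≠ 0 → v (x * y) = v x + v y := fun x y hx hy => by
    simp only [v, map_mul]
    exact hmul _ _ (h0 hx) (h0 hy)
  have vadd : ∀ x y : R, x ≠ 0 → y ≠ 0 → x + y ≠ 0 → min (v x) (v y) ≤ v (x + y) := by
    intro x y hx hy hxy
    have := hadd _ _ (h0 hx) (h0 hy) (by simpa using h0 hxy)
    simpa only [v, map_add] using this
  let F := valueIdeal v vmul vadd hnonneg
  have ht₁fst : (ofLex t₁).1 ≤ 0 := by
    obtain ⟨x, hxm, hxp⟩ := SetLike.exists_of_lt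
      (lt_of_le_of_ne (IsLocalRing.le_maximalIdeal_of_isPrime p₂) hp₂nem)
    rw [hp₂, not_or, not_lt] at hxp
    exact (Prod.Lex.monotone_fst _ _ (ht₁.2 ⟨x, hxm, hxp.1, rfl⟩)).trans hxp.2
  obtain ⟨s, g, hs, hg, hart⟩ := exists_finset_isArtinianRing_quotient p₂ e he
  have hfin := length_quotient_smul_top_ne_top (M := F φt) (p₂ ⊔ Ideal.span (g '' s))
  obtain ⟨ℓ, hℓ⟩ := ENat.ne_top_iff_exists.1 hfin
  have hbound : ∀ n : ℕ, ∀ T : Finset (ℝ ×ₗ ℝ),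
      (∀ γ ∈ T, φt ≤ γ ∧ γ < φt + n • t₁ ∧ ∃ x : R, x ≠ 0 ∧ v x = γ) → T.card ≤ ℓ * n ^ e := by
    intro n T hT
    have hle : p₂ ⊔ Ideal.span ((fun a => g a ^ n) '' s) ≤ F (n • t₁) := by
      refine sup_le (fun x hx hx0 => ?_) (Ideal.span_le.2 ?_)
      · refine (Prod.Lex.lt_iff.2 (Or.inl ?_)).le
        refine lt_of_le_of_lt ?_ (((hp₂ x).1 hx).resolve_left hx0)
        change n • (ofLex t₁).1 ≤ 0
        exact nsmul_nonpos ht₁fst n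
      · rintro _ ⟨a, ha, rfl⟩ hne
        have hvpow : ∀ (x : R), x ∈ IsLocalRing.maximalIdeal R → x ≠ 0 → n • t₁ ≤ v (x ^ n) := by
          intro x hxm hx
          have hx1 : t₁ ≤ v x := ht₁.2 ⟨x, hxm, hx, rfl⟩
          clear hT hne
          induction n with
          | zero => simpa [v] using hnonneg 1 one_ne_zero
          | succ n ih =>
            rw [succ_nsmul, pow_succ, vmul _ _ (pow_ne_zero _ hx) hx]
            exact add_le_add ih hx1
        by_cases hga : g a = 0
        · rcases n.eq_zero_or_pos with rfl | hn
          · simpa [v] using hnonneg 1 one_ne_zero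
          · exact absurd (by simp [hga, hn.ne']) hne
        · exact hvpow _ (hg a ha) hga
    have hsub : p₂ • (⊤ : Submodule R (F φt)) ⊔
        Ideal.span ((fun a => g a ^ n) '' s) • (⊤ : Submodule R (F φt)) ≤
        Submodule.comap (F φt).subtype (F (φt + n • t₁)) := by
      rw [← Submodule.sup_smul, Submodule.smul_le]
      intro r hr y _ hne
      have hne' : r * (y : R) ≠ 0 := hne
      have hr0 := left_ne_zero_of_mul hne'
      have hy0 := right_ne_zero_of_mul hne'
      change _ ≤ v (r * (y : R))
      rw [vmul _ _ hr0 hy0, add_comm]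
      exact add_le_add (hle hr hr0) (y.2 hy0)
    have h1 := card_le_length_valueIdeal v vmul vadd hnonneg φt (φt + n • t₁) T hT
    have h2 := Module.length_le_of_surjective _ (Submodule.factor_surjective hsub)
    have h3 := length_quotient_sup_span_pow_smul_top_le g n s (p₂ • (⊤ : Submodule R (F φt)))
    rw [← Submodule.sup_smul p₂ (Ideal.span (g '' s)), ← hℓ, hs] at h3
    have h4 := (h1.trans h2).trans h3
    rw [mul_comm]
    exact_mod_cast h4
  refine ⟨ℓ + 1, 0, fun n hn => ?_⟩
  set X := {γ : ℝ ×ₗ ℝ | (∃ x : R, x ∈ IsLocalRing.maximalIdeal R ∧ x ≠ 0 ∧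
          ν (algebraMap R K x) = γ) ∧ φt ≤ γ ∧ γ < φt + n • t₁}
  have hX : ∀ T : Finset (ℝ ×ₗ ℝ), (T : Set (ℝ ×ₗ ℝ)) ⊆ X → T.card ≤ ℓ * n ^ e := by
    intro T hT
    refine hbound n T fun γ hγ => ?_
    obtain ⟨⟨x, -, hx⟩, h1, h2⟩ := hT hγ
    exact ⟨h1, h2, x, hx⟩
  have hXfin : X.Finite := by
    by_contra hinf
    obtain ⟨T, hT, hc⟩ := Set.Infinite.exists_subset_card_eq hinf (ℓ * n ^ e + 1)
    have := hX T hT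
    omega
  refine ⟨hXfin, ?_⟩
  rw [Set.ncard_eq_toFinset_card X hXfin]
  refine (hX _ (by simp)).trans_lt ?_
  exact Nat.mul_lt_mul_of_pos_right (Nat.lt_succ_self ℓ) (pow_pos hn e)
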